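/- There exists a universal constant C > 0 with the following property: for all signs σ, σ₁, σ₂, σ₃ ∈ {−1, 1}, all dyadic numbers N₁₂₃, N₁, N₂, every m ∈ ℤ and every n₃ ∈ ℤ², the cardinality of the set { (n₁, n₂) ∈ (ℤ²)² : |n₁| ∼ N₁, |n₂| ∼ N₂, |n₁+n₂+n₃| ∼ N₁₂₃ and |φ(n₁,n₂,n₃) − m| ≤ 1 } is at most C · med(N₁₂₃, N₁, N₂)² · min(N₁₂₃, N₁, N₂)^{3/2}. -/

import Mathlib

/-- The Euclidean norm of a lattice point `x ∈ ℤ²`. -/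
noncomputable def znorm (x : Fin 2 → ℤ) : ℝ :=
  Real.sqrt ((x 0 : ℝ) ^ 2 + (x 1 : ℝ) ^ 2)

/-- The Japanese bracket `⟨x⟩ = √(1 + |x|²)` for lattice points `x ∈ ℤ²`. -/
noncomputable def jb (x : Fin 2 → ℤ) : ℝ :=
  Real.sqrt (1 + (x 0 : ℝ) ^ 2 + (x 1 : ℝ) ^ 2)

/-- `|x| ∼ N`, i.e. `N/2 ≤ |x| ≤ 2N`. -/
def ann (N : ℝ) (x : Fin 2 → ℤ) : Prop :=
  N / 2 ≤ znorm x ∧ znorm x ≤ 2 * N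

/-- The cubic phase function `φ(n₁,n₂,n₃) = σ⟨n₁+n₂+n₃⟩ + σ₁⟨n₁⟩ + σ₂⟨n₂⟩ + σ₃⟨n₃⟩`. -/
noncomputable def phase (σ σ₁ σ₂ σ₃ : ℝ) (n₁ n₂ n₃ : Fin 2 → ℤ) : ℝ :=
  σ * jb (n₁ + n₂ + n₃) + σ₁ * jb n₁ + σ₂ * jb n₂ + σ₃ * jb n₃

/-- The median (middle value) of three real numbers. -/
noncomputable def med3 (a b c : ℝ) : ℝ :=
  max (min a b) (min (max a b) c)

/-- The counting set of the cubic sup-counting estimate (second form): for fixed `n₃`, pairs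
`(n₁, n₂)` with `|n₁| ∼ N₁`, `|n₂| ∼ N₂`, `|n₁+n₂+n₃| ∼ N₁₂₃` and `|φ − m| ≤ 1`. -/
def cubicSupSet' (σ σ₁ σ₂ σ₃ N₁ N₂ N₁₂₃ : ℝ) (n₃ : Fin 2 → ℤ) (m : ℤ) :
    Set ((Fin 2 → ℤ) × (Fin 2 → ℤ)) :=
  {p | ann N₁ p.1 ∧ ann N₂ p.2 ∧ ann N₁₂₃ (p.1 + p.2 + n₃) ∧
    |phase σ σ₁ σ₂ σ₃ p.1 p.2 n₃ - (m : ℝ)| ≤ 1}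

lemma sqrt_add_sq_ge_quadratic {q u v H : ℝ} (hq : 0 < q)
    (hu : √(q + u ^ 2) ≤ H) (hv : √(q + v ^ 2) ≤ H) :
    √(q + v ^ 2) + v / √(q + v ^ 2) * (u - v) + q / (2 * H ^ 3) * (u - v) ^ 2
      ≤ √(q + u ^ 2) := by
  have hu0 : 0 < √(q + u ^ 2) := Real.sqrt_pos.2 (by positivity)
  have hv0 : 0 < √(q + v ^ 2) := Real.sqrt_pos.2 (by positivity)
  have hu2 : √(q + u ^ 2) ^ 2 = q + u ^ 2 := Real.sq_sqrt (by positivity)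
  have hv2 : √(q + v ^ 2) ^ 2 = q + v ^ 2 := Real.sq_sqrt (by positivity)
  generalize √(q + u ^ 2) = a at *
  generalize √(q + v ^ 2) = b at *
  have hH : 0 < H := hu0.trans_le hu
  have hab : 0 < a * b := mul_pos hu0 hv0
  have hid : (a * b - (q + u * v)) * (a * b + (q + u * v)) = q * (u - v) ^ 2 := by
    have : a ^ 2 * b ^ 2 = (q + u ^ 2) * (q + v ^ 2) := by rw [hu2, hv2]
    linear_combination this
  have hle : q + u * v ≤ a * b := by
    refine le_of_sq_le_sq ?_ hab.le
    nlinarith [mul_nonneg hq.le (sq_nonneg (u - v))]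
  have habH : b * (a * b) ≤ H ^ 3 := by
    calc b * (a * b) ≤ H * (H * H) := by gcongr
      _ = H ^ 3 := by ring
  have hkey : q * (u - v) ^ 2 ≤ (a * b - (q + u * v)) * (2 * (a * b)) := by
    rw [← hid]
    exact mul_le_mul_of_nonneg_left (by linarith) (by linarith)
  have h1 : q / (2 * H ^ 3) * (u - v) ^ 2 ≤ (a * b - (q + u * v)) / b := by
    rw [div_mul_eq_mul_div, div_le_div_iff₀ (by positivity) hv0]
    calc q * (u - v) ^ 2 * b ≤ (a * b - (q + u * v)) * (2 * (a * b)) * b := by gcongr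
      _ = (a * b - (q + u * v)) * (2 * (b * (a * b))) := by ring
      _ ≤ (a * b - (q + u * v)) * (2 * H ^ 3) := by
        apply mul_le_mul_of_nonneg_left _ (by linarith)
        linarith
  have h2 : a - b - v / b * (u - v) = (a * b - (q + u * v)) / b := by
    field_simp
    linear_combination -hv2
  linarith

lemma sqrt_add_sq_second_difference {q u v w H : ℝ} (hq : 0 < q) (huv : u < v) (hvw : v < w)
    (hu : √(q + u ^ 2) ≤ H) (hv : √(q + v ^ 2) ≤ H) (hw : √(q + w ^ 2) ≤ H) :
    q / (2 * H ^ 3) * ((v - u) * (w - v)) * (w - u) ≤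
      (w - v) * √(q + u ^ 2) + (v - u) * √(q + w ^ 2) - (w - u) * √(q + v ^ 2) := by
  have h1 := mul_le_mul_of_nonneg_left (sqrt_add_sq_ge_quadratic hq hu hv) (sub_pos.2 hvw).le
  have h2 := mul_le_mul_of_nonneg_left (sqrt_add_sq_ge_quadratic hq hw hv) (sub_pos.2 huv).le
  linear_combination h1 + h2

lemma abs_sqrt_add_sq_sub_le {q : ℝ} (hq : 0 < q) (u w : ℝ) :
    |√(q + u ^ 2) - √(q + w ^ 2)| ≤ |u - w| := by
  have hu0 : 0 < √(q + u ^ 2) := Real.sqrt_pos.2 (by positivity)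
  have hw0 : 0 < √(q + w ^ 2) := Real.sqrt_pos.2 (by positivity)
  have hu2 : √(q + u ^ 2) ^ 2 = q + u ^ 2 := Real.sq_sqrt (by positivity)
  have hw2 : √(q + w ^ 2) ^ 2 = q + w ^ 2 := Real.sq_sqrt (by positivity)
  generalize √(q + u ^ 2) = a at *
  generalize √(q + w ^ 2) = b at *
  apply sq_le_sq.1
  have hle : q + u * w ≤ a * b := by
    refine le_of_sq_le_sq ?_ (mul_pos hu0 hw0).le
    have : a ^ 2 * b ^ 2 = (q + u ^ 2) * (q + w ^ 2) := by rw [hu2, hw2]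
    nlinarith [mul_nonneg hq.le (sq_nonneg (u - w))]
  nlinarith

lemma card_le_of_forall_sub_le {S : Finset ℤ} {D : ℝ} (hD : 0 ≤ D)
    (h : ∀ u ∈ S, ∀ w ∈ S, (w : ℝ) - u ≤ D) : (S.card : ℝ) ≤ D + 1 := by
  rcases S.eq_empty_or_nonempty with rfl | hS
  · simp; linarith
  have hsub : S ⊆ Finset.Icc (S.min' hS) (S.min' hS + ⌊D⌋) := by
    intro v hv
    rw [Finset.mem_Icc]
    refine ⟨S.min'_le v hv, ?_⟩
    have : v - S.min' hS ≤ ⌊D⌋ := by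
      rw [Int.le_floor]
      push_cast
      exact h _ (S.min'_mem hS) _ hv
    omega
  have hcard := Finset.card_le_card hsub
  rw [Int.card_Icc] at hcard
  have h0 : 0 ≤ ⌊D⌋ := Int.floor_nonneg.2 hD
  have : (S.card : ℤ) ≤ ⌊D⌋ + 1 := by omega
  have : (S.card : ℝ) ≤ ⌊D⌋ + 1 := by exact_mod_cast this
  linarith [Int.floor_le D]

lemma card_le_of_sqrt_convex {S : Finset ℤ} {q H μ β c K D : ℝ} (hq : 0 < q) (hD : 0 ≤ D)
    (hH : ∀ t ∈ S, √(q + (t : ℝ) ^ 2) ≤ H)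
    (hK : ∀ t ∈ S, |μ * √(q + (t : ℝ) ^ 2) - β * t - c| ≤ K)
    (hpos : 0 < |μ| * (q / (2 * H ^ 3)))
    (hKD : 2 * K ≤ |μ| * (q / (2 * H ^ 3)) * D ^ 2) :
    (S.card : ℝ) ≤ 2 * (D + 1) := by
  rcases S.eq_empty_or_nonempty with rfl | hS
  · simp; linarith
  set u := S.min' hS
  set w := S.max' hS
  have hu : u ∈ S := S.min'_mem hS
  have hw : w ∈ S := S.max'_mem hS
  have key : ∀ v ∈ S, (v : ℝ) - u ≤ D ∨ (w : ℝ) - v ≤ D := by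
    intro v hv
    by_contra! hcon
    obtain ⟨h1, h2⟩ := hcon
    have huv : (u : ℝ) < v := by linarith
    have hvw : (v : ℝ) < w := by linarith
    have hsd := sqrt_add_sq_second_difference hq huv hvw (hH u hu) (hH v hv) (hH w hw)
    have e1 := abs_le.1 (hK u hu)
    have e2 := abs_le.1 (hK v hv)
    have e3 := abs_le.1 (hK w hw)
    have hDD : D ^ 2 < ((v : ℝ) - u) * (w - v) := by
      rw [sq]; exact mul_lt_mul'' h1 h2 hD hD
    generalize √(q + (u : ℝ) ^ 2) = a at *
    generalize √(q + (v : ℝ) ^ 2) = b at *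
    generalize √(q + (w : ℝ) ^ 2) = d at *
    have hup : |μ| * ((w - v) * a + (v - u) * d - (w - u) * b) ≤ 2 * K * ((w : ℝ) - u) := by
      have hd1 : (0 : ℝ) ≤ w - v := by linarith
      have hd2 : (0 : ℝ) ≤ v - u := by linarith
      have hd3 : (0 : ℝ) ≤ w - u := by linarith
      rcases abs_cases μ with ⟨h, -⟩ | ⟨h, -⟩ <;> rw [h]
      · linarith [mul_le_mul_of_nonneg_left e1.2 hd1, mul_le_mul_of_nonneg_left e3.2 hd2,
          mul_le_mul_of_nonneg_left e2.1 hd3]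
      · linarith [mul_le_mul_of_nonneg_left e1.1 hd1, mul_le_mul_of_nonneg_left e3.1 hd2,
          mul_le_mul_of_nonneg_left e2.2 hd3]
    have hlow := mul_le_mul_of_nonneg_left hsd (abs_nonneg μ)
    have hwu : (0 : ℝ) < w - u := by linarith
    have h3 := mul_lt_mul_of_pos_right (mul_lt_mul_of_pos_left hDD hpos) hwu
    have h4 := mul_le_mul_of_nonneg_right hKD hwu.le
    linarith
  have hsplit : S = S.filter (fun v : ℤ => (v : ℝ) - u ≤ D) ∪
      S.filter (fun v : ℤ => (w : ℝ) - v ≤ D) := by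
    rw [← Finset.filter_or, Finset.filter_true_of_mem key]
  have c1 : ((S.filter (fun v : ℤ => (v : ℝ) - u ≤ D)).card : ℝ) ≤ D + 1 := by
    apply card_le_of_forall_sub_le hD
    intro s hs t ht
    rw [Finset.mem_filter] at hs ht
    have : (u : ℝ) ≤ s := by exact_mod_cast S.min'_le s hs.1
    linarith [ht.2]
  have c2 : ((S.filter (fun v : ℤ => (w : ℝ) - v ≤ D)).card : ℝ) ≤ D + 1 := by
    apply card_le_of_forall_sub_le hD
    intro s hs t ht
    rw [Finset.mem_filter] at hs ht
    have : (t : ℝ) ≤ w := by exact_mod_cast S.le_max' t ht.1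
    linarith [hs.2]
  have : (S.card : ℝ) ≤ (S.filter (fun v : ℤ => (v : ℝ) - u ≤ D)).card +
      (S.filter (fun v : ℤ => (w : ℝ) - v ≤ D)).card := by
    conv_lhs => rw [hsplit]
    exact_mod_cast Finset.card_union_le _ _
  linarith

lemma card_le_of_sqrt_linear {S : Finset ℤ} {q μ β c K M : ℝ} (hq : 0 < q) (hM : 0 < M)
    (hK0 : 0 ≤ K) (hβ : M ≤ |β|) (hμ : |μ| ≤ M / 2)
    (hK : ∀ t ∈ S, |μ * √(q + (t : ℝ) ^ 2) - β * t - c| ≤ K) :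
    (S.card : ℝ) ≤ 4 * K / M + 1 := by
  apply card_le_of_forall_sub_le (by positivity)
  intro u hu w hw
  rw [le_div_iff₀ hM]
  have e1 := hK u hu
  have e2 := hK w hw
  have hl := mul_le_mul hμ (abs_sqrt_add_sq_sub_le hq u w) (abs_nonneg _) (by positivity)
  rw [← abs_mul] at hl
  generalize √(q + (u : ℝ) ^ 2) = a at *
  generalize √(q + (w : ℝ) ^ 2) = b at *
  have h1 : |β * ((u : ℝ) - w)| ≤ 2 * K + M / 2 * |(u : ℝ) - w| := by
    rw [abs_le] at *
    constructor <;> linarith [e1.1, e1.2, e2.1, e2.2, hl.1, hl.2]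
  rw [abs_mul] at h1
  have h2 := mul_le_mul_of_nonneg_right hβ (abs_nonneg ((u : ℝ) - w))
  have h3 : (w : ℝ) - u ≤ |(u : ℝ) - w| := by rw [abs_sub_comm]; exact le_abs_self _
  have h4 := mul_le_mul_of_nonneg_right h3 hM.le
  linarith

section Fibers

variable {α : Type*}

lemma card_le_sum_of_fiber_le {S : Finset α} {f : α → ℤ} {T : Finset ℤ} {F : ℤ → ℝ}
    (hT : ∀ p ∈ S, f p ∈ T) (hF : ∀ j ∈ T, ((S.filter (fun p => f p = j)).card : ℝ) ≤ F j) :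
    (S.card : ℝ) ≤ ∑ j ∈ T, F j := by
  rw [Finset.card_eq_sum_card_fiberwise hT]
  push_cast
  exact Finset.sum_le_sum hF

lemma card_Icc_floor_le {R : ℝ} (hR : 1 ≤ R) :
    ((Finset.Icc (-⌊2 * R⌋) ⌊2 * R⌋).card : ℝ) ≤ 5 * R := by
  have h0 : 0 ≤ ⌊2 * R⌋ := Int.floor_nonneg.2 (by linarith)
  have : ((Finset.Icc (-⌊2 * R⌋) ⌊2 * R⌋).card : ℤ) = 2 * ⌊2 * R⌋ + 1 := by
    rw [Int.card_Icc]; omega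
  have : ((Finset.Icc (-⌊2 * R⌋) ⌊2 * R⌋).card : ℝ) = 2 * ⌊2 * R⌋ + 1 := by exact_mod_cast this
  linarith [Int.floor_le (2 * R)]

lemma mem_Icc_floor {R : ℝ} {x : ℤ} (hx : |(x : ℝ)| ≤ 2 * R) :
    x ∈ Finset.Icc (-⌊2 * R⌋) ⌊2 * R⌋ := by
  rw [abs_le] at hx
  have h1 : x ≤ ⌊2 * R⌋ := Int.le_floor.2 hx.2
  have h2 : -x ≤ ⌊2 * R⌋ := Int.le_floor.2 (by push_cast; linarith)
  rw [Finset.mem_Icc]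
  omega

lemma card_le_mul_of_fiber_le {S : Finset α} {x : α → ℤ} {R Q : ℝ} (hR : 1 ≤ R) (hQ : 0 ≤ Q)
    (hx : ∀ p ∈ S, |(x p : ℝ)| ≤ 2 * R)
    (hF : ∀ j, ((S.filter (fun p => x p = j)).card : ℝ) ≤ Q) : (S.card : ℝ) ≤ 5 * R * Q := by
  refine (card_le_sum_of_fiber_le (fun p hp => mem_Icc_floor (hx p hp))
    (fun j _ => hF j)).trans ?_
  rw [Finset.sum_const, nsmul_eq_mul]
  exact mul_le_mul_of_nonneg_right (card_Icc_floor_le hR) hQ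

lemma card_fiber_le_of_image {S : Finset α} {x y : α → ℤ} {j : ℤ} {Q : ℝ}
    (hinj : ∀ p ∈ S, ∀ r ∈ S, x p = x r → y p = y r → p = r)
    (h : ∀ T : Finset ℤ, (∀ t ∈ T, ∃ p ∈ S, x p = j ∧ y p = t) → (T.card : ℝ) ≤ Q) :
    ((S.filter (fun p => x p = j)).card : ℝ) ≤ Q := by
  classical
  rw [← Finset.card_image_of_injOn (f := y)]
  · apply h
    intro t ht
    simp only [Finset.mem_image, Finset.mem_filter] at ht
    obtain ⟨p, ⟨hp, hj⟩, ht⟩ := ht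
    exact ⟨p, hp, hj, ht⟩
  · intro p hp r hr hpr
    simp only [Finset.coe_filter, Set.mem_ofPred_eq] at hp hr
    exact hinj p hp.1 r hr.1 (hp.2.trans hr.2.symm) hpr

lemma card_le_of_convex_slices {S : Finset α} {x y : α → ℤ} {A μ γ β c K D : ℝ} (hA : 1 ≤ A)
    (hinj : ∀ p ∈ S, ∀ r ∈ S, x p = x r → y p = y r → p = r)
    (hup : ∀ p ∈ S, (x p : ℝ) ^ 2 + (y p : ℝ) ^ 2 ≤ 4 * A ^ 2)
    (hlow : ∀ p ∈ S, A ^ 2 / 8 ≤ 1 + (x p : ℝ) ^ 2)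
    (hK : ∀ p ∈ S, |μ * √(1 + (x p : ℝ) ^ 2 + (y p : ℝ) ^ 2) - γ * x p - β * y p - c| ≤ K)
    (hD : 0 ≤ D) (hμ : 0 < |μ|) (hKD : 2 * K ≤ |μ| * (1 / (432 * A)) * D ^ 2) :
    (S.card : ℝ) ≤ 5 * A * (2 * (D + 1)) := by
  have hx : ∀ p ∈ S, |(x p : ℝ)| ≤ 2 * A := by
    intro p hp
    apply abs_le_of_sq_le_sq _ (by linarith)
    nlinarith [hup p hp, sq_nonneg (y p : ℝ)]
  apply card_le_mul_of_fiber_le hA (by linarith) hx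
  intro j
  apply card_fiber_le_of_image hinj
  intro T hT
  rcases T.eq_empty_or_nonempty with rfl | ⟨t₀, ht₀⟩
  · simp; linarith
  have hj : A ^ 2 / 8 ≤ 1 + (j : ℝ) ^ 2 := by
    obtain ⟨p, hp, rfl, -⟩ := hT t₀ ht₀
    exact hlow p hp
  have hq : 1 / (432 * A) ≤ (1 + (j : ℝ) ^ 2) / (2 * (3 * A) ^ 3) := by
    rw [div_le_div_iff₀ (by positivity) (by positivity)]
    nlinarith [mul_le_mul_of_nonneg_left hj (by linarith : 0 ≤ 432 * A)]
  have hA0 : 0 < A := by linarith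
  refine card_le_of_sqrt_convex (q := 1 + (j : ℝ) ^ 2) (H := 3 * A) (μ := μ) (β := β)
    (c := c + γ * j) (K := K) (by positivity) hD ?_ ?_ (by positivity) ?_
  · intro t ht
    obtain ⟨p, hp, rfl, rfl⟩ := hT t ht
    rw [Real.sqrt_le_left (by positivity)]
    nlinarith [hup p hp]
  · intro t ht
    obtain ⟨p, hp, rfl, rfl⟩ := hT t ht
    convert hK p hp using 2
    ring
  · refine hKD.trans ?_
    gcongr

lemma card_le_of_linear_slices {S : Finset α} {x y : α → ℤ} {A μ γ β c K M : ℝ} (hA : 1 ≤ A)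
    (hinj : ∀ p ∈ S, ∀ r ∈ S, x p = x r → y p = y r → p = r)
    (hx : ∀ p ∈ S, |(x p : ℝ)| ≤ 2 * A)
    (hK : ∀ p ∈ S, |μ * √(1 + (x p : ℝ) ^ 2 + (y p : ℝ) ^ 2) - γ * x p - β * y p - c| ≤ K)
    (hK0 : 0 ≤ K) (hM : 0 < M) (hβ : M ≤ |β|) (hμ : |μ| ≤ M / 2) :
    (S.card : ℝ) ≤ 5 * A * (4 * K / M + 1) := by
  apply card_le_mul_of_fiber_le hA (by positivity) hx
  intro j
  apply card_fiber_le_of_image hinj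
  intro T hT
  refine card_le_of_sqrt_linear (q := 1 + (j : ℝ) ^ 2) (c := c + γ * j) (by positivity)
    hM hK0 hβ hμ ?_
  intro t ht
  obtain ⟨p, hp, rfl, rfl⟩ := hT t ht
  convert hK p hp using 2
  ring

end Fibers

lemma abs_linearized_phase_le {A M x y l₀ l₁ s μ : ℝ} (hA : 1 ≤ A) (hM : 1 ≤ M)
    (hs : s = -1 ∨ s = 1) (hxy : x ^ 2 + y ^ 2 ≤ 4 * A ^ 2) (hl₀ : |l₀| ≤ M) (hl₁ : |l₁| ≤ M)
    (h : |√(1 + x ^ 2 + y ^ 2) + s * √(1 + (l₀ - x) ^ 2 + (l₁ - y) ^ 2) - μ| ≤ 1) :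
    |μ * √(1 + x ^ 2 + y ^ 2) - l₀ * x - l₁ * y - (μ ^ 2 - l₀ ^ 2 - l₁ ^ 2) / 2|
      ≤ 4 * (A + M) := by
  have h0 : √(1 + (l₀ - x) ^ 2 + (l₁ - y) ^ 2) ≤ 3 * A + 2 * M := by
    rw [Real.sqrt_le_left (by positivity)]
    have e0 := sq_le_sq.2 (hl₀.trans (le_abs_self M))
    have e1 := sq_le_sq.2 (hl₁.trans (le_abs_self M))
    have hc : -(l₀ * x + l₁ * y) ≤ 4 * A * M := by
      apply le_trans (neg_le_abs _)
      apply abs_le_of_sq_le_sq _ (by positivity)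
      have : (l₀ * x + l₁ * y) ^ 2 ≤ (l₀ ^ 2 + l₁ ^ 2) * (x ^ 2 + y ^ 2) := by
        nlinarith [sq_nonneg (l₀ * y - l₁ * x)]
      refine this.trans ?_
      calc (l₀ ^ 2 + l₁ ^ 2) * (x ^ 2 + y ^ 2) ≤ (2 * M ^ 2) * (4 * A ^ 2) := by
            gcongr; linarith
        _ ≤ _ := by nlinarith [mul_nonneg (sq_nonneg M) (sq_nonneg A)]
    nlinarith [mul_nonneg (sub_nonneg.2 hA) (sub_nonneg.2 hM)]
  have ha2 : √(1 + x ^ 2 + y ^ 2) ^ 2 = 1 + x ^ 2 + y ^ 2 := Real.sq_sqrt (by positivity)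
  have hb2 : √(1 + (l₀ - x) ^ 2 + (l₁ - y) ^ 2) ^ 2 = 1 + (l₀ - x) ^ 2 + (l₁ - y) ^ 2 :=
    Real.sq_sqrt (by positivity)
  have hb0 := Real.sqrt_nonneg (1 + (l₀ - x) ^ 2 + (l₁ - y) ^ 2)
  generalize √(1 + x ^ 2 + y ^ 2) = a at *
  generalize √(1 + (l₀ - x) ^ 2 + (l₁ - y) ^ 2) = b at *
  set e := a + s * b - μ with he
  have hs2 : s ^ 2 = 1 := by rcases hs with rfl | rfl <;> norm_num
  have hid : μ * a - l₀ * x - l₁ * y - (μ ^ 2 - l₀ ^ 2 - l₁ ^ 2) / 2 = e * (s * b) - e ^ 2 / 2 := by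
    have hμ : μ = a + s * b - e := by rw [he]; ring
    rw [hμ]
    linear_combination ha2 / 2 - hb2 / 2 - b ^ 2 / 2 * hs2
  rw [hid]
  have h1 : |e * (s * b)| ≤ b := by
    have : |s| = 1 := by rcases hs with rfl | rfl <;> norm_num
    rw [abs_mul, abs_mul, this, abs_of_nonneg hb0]
    nlinarith
  have h2 : e ^ 2 ≤ 1 := by
    rw [← sq_abs]; nlinarith [abs_nonneg e]
  rw [abs_le] at h1 ⊢
  constructor <;> nlinarith [h1.1, h1.2, sq_nonneg e]

lemma sq_sqrt_add_div_sqrt_ge {A M : ℝ} (hA : 1 ≤ A) (hM : 1 ≤ M) :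
    A + A ^ 2 / M ≤ (√A + A / √M) ^ 2 := by
  have h1 : √A ^ 2 = A := Real.sq_sqrt (by linarith)
  have h2 : (A / √M) ^ 2 = A ^ 2 / M := by
    rw [div_pow, Real.sq_sqrt (by linarith)]
  have h3 : 0 ≤ √A * (A / √M) := by positivity
  nlinarith

section Fibers

variable {α : Type*}

lemma card_bracket_le_of_large_shift {S : Finset α} {x y : α → ℤ} {A M l₀ l₁ s μ : ℝ}
    (hA : 1 ≤ A) (hM : 1 ≤ M) (hl₀ : |l₀| ≤ M) (hl₁ : |l₁| ≤ M) (hl : M = |l₀| ∨ M = |l₁|)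
    (hs : s = -1 ∨ s = 1)
    (hinj : ∀ p ∈ S, ∀ r ∈ S, x p = x r → y p = y r → p = r)
    (hlow : ∀ p ∈ S, A ^ 2 / 4 ≤ (x p : ℝ) ^ 2 + (y p : ℝ) ^ 2)
    (hup : ∀ p ∈ S, (x p : ℝ) ^ 2 + (y p : ℝ) ^ 2 ≤ 4 * A ^ 2)
    (h : ∀ p ∈ S, |√(1 + (x p : ℝ) ^ 2 + (y p : ℝ) ^ 2) +
      s * √(1 + (l₀ - x p) ^ 2 + (l₁ - y p) ^ 2) - μ| ≤ 1) :
    (S.card : ℝ) ≤ 2100 * (A * (√A + A / √M)) := by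
  have hA0 : 0 < A := by linarith
  have hM0 : 0 < M := by linarith
  have hK := fun p hp => abs_linearized_phase_le hA hM hs (hup p hp) hl₀ hl₁ (h p hp)
  have hK' : ∀ p ∈ S, |μ * √(1 + (y p : ℝ) ^ 2 + (x p : ℝ) ^ 2) - l₁ * y p - l₀ * x p -
      (μ ^ 2 - l₀ ^ 2 - l₁ ^ 2) / 2| ≤ 4 * (A + M) := by
    intro p hp
    convert hK p hp using 2
    rw [add_right_comm]
    ring
  have hinj' : ∀ p ∈ S, ∀ r ∈ S, y p = y r → x p = x r → p = r :=
    fun p hp r hr h1 h2 => hinj p hp r hr h2 h1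
  have hup' : ∀ p ∈ S, (y p : ℝ) ^ 2 + (x p : ℝ) ^ 2 ≤ 4 * A ^ 2 :=
    fun p hp => by linarith [hup p hp]
  have hE := sq_sqrt_add_div_sqrt_ge hA hM
  have hA1 : 1 ≤ √A := Real.one_le_sqrt.2 hA
  have hE0 : 0 ≤ A / √M := by positivity
  rcases le_or_gt |μ| (M / 2) with hμ | hμ
  · have hx : ∀ p ∈ S, |(x p : ℝ)| ≤ 2 * A := by
      intro p hp
      apply abs_le_of_sq_le_sq _ (by linarith)
      nlinarith [hup p hp, sq_nonneg (y p : ℝ)]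
    have hy : ∀ p ∈ S, |(y p : ℝ)| ≤ 2 * A := by
      intro p hp
      apply abs_le_of_sq_le_sq _ (by linarith)
      nlinarith [hup p hp, sq_nonneg (x p : ℝ)]
    have hb : (S.card : ℝ) ≤ 5 * A * (4 * (4 * (A + M)) / M + 1) := by
      rcases hl with hl | hl
      · exact card_le_of_linear_slices hA hinj' hy hK' (by positivity) hM0 hl.le hμ
      · exact card_le_of_linear_slices hA hinj hx hK (by positivity) hM0 hl.le hμ
    have hsM : √M ≤ M := Real.sqrt_le_left hM0.le |>.2 (by nlinarith)
    have hdiv : A / M ≤ A / √M := by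
      have : 0 < √M := Real.sqrt_pos.2 hM0
      gcongr
    have : 4 * (4 * (A + M)) / M + 1 = 16 * (A / M) + 17 := by field_simp; ring
    rw [this] at hb
    have h5 : 5 * A * (16 * (A / M) + 17) ≤ 5 * A * (420 * (√A + A / √M)) := by
      refine mul_le_mul_of_nonneg_left ?_ (by positivity)
      linarith
    linarith
  · set D := 100 * (√A + A / √M) with hDdef
    have hD1 : 100 ≤ D := by linarith
    have hμ0 : 0 < |μ| := by linarith
    have hKD : 2 * (4 * (A + M)) ≤ |μ| * (1 / (432 * A)) * D ^ 2 := by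
      have e1 : 10000 * (A + A ^ 2 / M) ≤ D ^ 2 := by rw [hDdef, mul_pow]; linarith
      calc 2 * (4 * (A + M)) ≤ M / 2 * (1 / (432 * A)) * (10000 * (A + A ^ 2 / M)) := by
            have : M / 2 * (1 / (432 * A)) * (10000 * (A + A ^ 2 / M)) =
                10000 / 864 * (A + M) := by field_simp; ring
            rw [this]; linarith
        _ ≤ _ := by gcongr
    have c1 : ((S.filter (fun p => (y p : ℝ) ^ 2 ≤ (x p : ℝ) ^ 2)).card : ℝ) ≤
        5 * A * (2 * (D + 1)) := by
      refine card_le_of_convex_slices (y := y) hA ?_ ?_ ?_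
        (fun p hp => hK p (Finset.mem_filter.1 hp).1) (by linarith) hμ0 hKD
      · exact fun p hp r hr => hinj p (Finset.mem_filter.1 hp).1 r (Finset.mem_filter.1 hr).1
      · exact fun p hp => hup p (Finset.mem_filter.1 hp).1
      · intro p hp
        rw [Finset.mem_filter] at hp
        linarith [hlow p hp.1, hp.2]
    have c2 : ((S.filter (fun p => ¬ (y p : ℝ) ^ 2 ≤ (x p : ℝ) ^ 2)).card : ℝ) ≤
        5 * A * (2 * (D + 1)) := by
      refine card_le_of_convex_slices (y := x) hA ?_ ?_ ?_
        (fun p hp => hK' p (Finset.mem_filter.1 hp).1) (by linarith) hμ0 hKD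
      · exact fun p hp r hr => hinj' p (Finset.mem_filter.1 hp).1 r (Finset.mem_filter.1 hr).1
      · exact fun p hp => hup' p (Finset.mem_filter.1 hp).1
      · intro p hp
        rw [Finset.mem_filter] at hp
        linarith [hlow p hp.1, hp.2]
    have hsum : (S.card : ℝ) = (S.filter (fun p => (y p : ℝ) ^ 2 ≤ (x p : ℝ) ^ 2)).card +
        (S.filter (fun p => ¬ (y p : ℝ) ^ 2 ≤ (x p : ℝ) ^ 2)).card := by
      exact_mod_cast (Finset.card_filter_add_card_filter_not _).symm
    have h5 : 5 * A * (2 * (D + 1)) ≤ 5 * A * (210 * (√A + A / √M)) := by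
      refine mul_le_mul_of_nonneg_left ?_ (by positivity)
      linarith
    linarith

lemma card_bracket_le {S : Finset α} {x y : α → ℤ} {A s μ : ℝ} (l₀ l₁ : ℤ)
    (hA : 1 ≤ A) (hs : s = -1 ∨ s = 1)
    (hinj : ∀ p ∈ S, ∀ r ∈ S, x p = x r → y p = y r → p = r)
    (hlow : ∀ p ∈ S, A ^ 2 / 4 ≤ (x p : ℝ) ^ 2 + (y p : ℝ) ^ 2)
    (hup : ∀ p ∈ S, (x p : ℝ) ^ 2 + (y p : ℝ) ^ 2 ≤ 4 * A ^ 2)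
    (h : ∀ p ∈ S, |√(1 + (x p : ℝ) ^ 2 + (y p : ℝ) ^ 2) +
      s * √(1 + (l₀ - x p : ℝ) ^ 2 + (l₁ - y p : ℝ) ^ 2) - μ| ≤ 1) :
    (S.card : ℝ) ≤ 2100 * (A * (√A + A * (1 / √(max 1 |(l₀ : ℝ)|)))) := by
  have hA0 : 0 < A := by linarith
  rcases lt_or_ge (max |(l₀ : ℝ)| |(l₁ : ℝ)|) 1 with hl | hl
  · have h0 : max 1 |(l₀ : ℝ)| = 1 := max_eq_left ((le_max_left _ _).trans hl.le)
    have hx : ∀ p ∈ S, |(x p : ℝ)| ≤ 2 * A := by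
      intro p hp
      apply abs_le_of_sq_le_sq _ (by linarith)
      nlinarith [hup p hp, sq_nonneg (y p : ℝ)]
    have hb : (S.card : ℝ) ≤ 5 * A * (4 * A + 1) := by
      apply card_le_mul_of_fiber_le hA (by positivity) hx
      intro j
      apply card_fiber_le_of_image hinj
      intro T hT
      apply card_le_of_forall_sub_le (by positivity)
      have hy : ∀ t ∈ T, |(t : ℝ)| ≤ 2 * A := by
        intro t ht
        obtain ⟨p, hp, -, rfl⟩ := hT t ht
        apply abs_le_of_sq_le_sq _ (by linarith)
        nlinarith [hup p hp, sq_nonneg (x p : ℝ)]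
      intro u hu w hw
      linarith [(abs_le.1 (hy u hu)).1, (abs_le.1 (hy w hw)).2]
    rw [h0, Real.sqrt_one]
    have : 0 ≤ A * √A := by positivity
    nlinarith
  · refine (card_bracket_le_of_large_shift hA hl (le_max_left _ _) (le_max_right _ _) ?_ hs hinj
      hlow hup h).trans ?_
    · rcases max_choice |(l₀ : ℝ)| |(l₁ : ℝ)| with h | h <;> simp [h]
    · have h1 : max 1 |(l₀ : ℝ)| ≤ max |(l₀ : ℝ)| |(l₁ : ℝ)| := max_le hl (le_max_left _ _)
      have h2 : 0 < √(max 1 |(l₀ : ℝ)|) := Real.sqrt_pos.2 (by positivity)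
      rw [mul_one_div]
      gcongr

end Fibers

lemma sum_Icc_one_div_sqrt_le (n : ℕ) :
    ∑ i ∈ Finset.Icc (-(n : ℤ)) n, 1 / √(max 1 |(i : ℝ)|) ≤ 1 + 4 * √(n : ℝ) := by
  induction n with
  | zero => simp
  | succ n ih =>
    have hIcc : Finset.Icc (-((n + 1 : ℕ) : ℤ)) ((n + 1 : ℕ) : ℤ) =
        insert (-((n : ℤ) + 1)) (insert ((n : ℤ) + 1) (Finset.Icc (-(n : ℤ)) n)) := by
      ext i
      simp only [Finset.mem_insert, Finset.mem_Icc]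
      omega
    rw [hIcc, Finset.sum_insert, Finset.sum_insert]
    · have hm : max 1 ((n : ℝ) + 1) = n + 1 := max_eq_right (by linarith [n.cast_nonneg (α := ℝ)])
      have habs : |(n : ℝ) + 1| = n + 1 := abs_of_pos (by positivity)
      push_cast
      rw [abs_neg, habs, hm]
      have hstep : 1 / √((n : ℝ) + 1) ≤ 2 * (√((n : ℝ) + 1) - √n) := by
        have h1 : 0 < √((n : ℝ) + 1) := Real.sqrt_pos.2 (by positivity)
        have h2 : √((n : ℝ) + 1) ^ 2 = n + 1 := Real.sq_sqrt (by positivity)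
        have h3 : √(n : ℝ) ^ 2 = n := Real.sq_sqrt (by positivity)
        rw [div_le_iff₀ h1]
        nlinarith [sq_nonneg (√((n : ℝ) + 1) - √n)]
      linarith
    · simp only [Finset.mem_Icc]; omega
    · simp only [Finset.mem_insert, Finset.mem_Icc]; omega

lemma sum_Icc_one_div_sqrt_shift_le {B : ℝ} (hB : 1 ≤ B) (k : ℤ) :
    ∑ j ∈ Finset.Icc (-⌊2 * B⌋) ⌊2 * B⌋, 1 / √(max 1 |((k - j : ℤ) : ℝ)|) ≤ 16 * √B := by
  obtain ⟨n, hn⟩ := Int.eq_ofNat_of_zero_le (Int.floor_nonneg.2 (by linarith : 0 ≤ 2 * B))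
  have hnB : (n : ℝ) ≤ 2 * B := by
    have := Int.floor_le (2 * B)
    rw [hn] at this
    exact_mod_cast this
  have hn2 : B ≤ n := by
    have := Int.lt_floor_add_one (2 * B)
    rw [hn] at this
    push_cast at this
    linarith
  have hcard := card_Icc_floor_le hB
  rw [hn] at hcard ⊢
  have hB1 : 1 ≤ √B := Real.one_le_sqrt.2 hB
  have hB2 : √B ^ 2 = B := Real.sq_sqrt (by linarith)
  rw [← Finset.sum_filter_add_sum_filter_not _ (fun j : ℤ => |k - j| ≤ n)]
  have s1 : ∑ j ∈ (Finset.Icc (-(n : ℤ)) n).filter (fun j : ℤ => |k - j| ≤ n),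
      1 / √(max 1 |((k - j : ℤ) : ℝ)|) ≤ 1 + 4 * √(n : ℝ) := by
    refine le_trans ?_ (sum_Icc_one_div_sqrt_le n)
    rw [← Finset.sum_image (f := fun i : ℤ => 1 / √(max 1 |(i : ℝ)|)) (g := fun j => k - j)
      (by intro a _ b _ hab; simpa using hab)]
    apply Finset.sum_le_sum_of_subset_of_nonneg
    · intro i hi
      simp only [Finset.mem_image, Finset.mem_filter] at hi
      obtain ⟨j, ⟨-, hj⟩, rfl⟩ := hi
      rw [Finset.mem_Icc]
      exact abs_le.1 hj
    · intro i _ _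
      positivity
  have s2 : ∑ j ∈ (Finset.Icc (-(n : ℤ)) n).filter (fun j : ℤ => ¬ |k - j| ≤ n),
      1 / √(max 1 |((k - j : ℤ) : ℝ)|) ≤ 5 * √B := by
    have hterm : ∀ j ∈ (Finset.Icc (-(n : ℤ)) n).filter (fun j : ℤ => ¬ |k - j| ≤ n),
        1 / √(max 1 |((k - j : ℤ) : ℝ)|) ≤ 1 / √B := by
      intro j hj
      have hj' := (Finset.mem_filter.1 hj).2
      rw [not_le] at hj'
      have hj2 : (n : ℝ) < |((k - j : ℤ) : ℝ)| := by exact_mod_cast hj'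
      have : B ≤ max 1 |((k - j : ℤ) : ℝ)| := le_max_of_le_right (by linarith)
      gcongr
    refine (Finset.sum_le_card_nsmul _ _ _ hterm).trans ?_
    rw [nsmul_eq_mul, mul_one_div, div_le_iff₀ (by linarith)]
    have : (((Finset.Icc (-(n : ℤ)) n).filter (fun j : ℤ => ¬ |k - j| ≤ n)).card : ℝ) ≤
        (Finset.Icc (-(n : ℤ)) n).card := by
      exact_mod_cast Finset.card_filter_le _ _
    nlinarith
  have hsn : √(n : ℝ) ≤ 2 * √B := by
    rw [Real.sqrt_le_left (by positivity)]
    nlinarith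
  linarith

lemma ann_sq_bounds {N : ℝ} {x : Fin 2 → ℤ} (hN : 0 ≤ N) (h : ann N x) :
    N ^ 2 / 4 ≤ (x 0 : ℝ) ^ 2 + (x 1 : ℝ) ^ 2 ∧ (x 0 : ℝ) ^ 2 + (x 1 : ℝ) ^ 2 ≤ 4 * N ^ 2 := by
  obtain ⟨h1, h2⟩ := h
  have hz0 : 0 ≤ znorm x := Real.sqrt_nonneg _
  have hz : znorm x ^ 2 = (x 0 : ℝ) ^ 2 + (x 1 : ℝ) ^ 2 := Real.sq_sqrt (by positivity)
  constructor <;> nlinarith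

lemma ann_abs_le {N : ℝ} {x : Fin 2 → ℤ} (hN : 0 ≤ N) (h : ann N x) (i : Fin 2) :
    |(x i : ℝ)| ≤ 2 * N := by
  have h1 := (ann_sq_bounds hN h).2
  apply abs_le_of_sq_le_sq _ (by linarith)
  fin_cases i <;> dsimp only [Fin.zero_eta, Fin.mk_one]
  · nlinarith [sq_nonneg (x 1 : ℝ)]
  · nlinarith [sq_nonneg (x 0 : ℝ)]

lemma card_triple_le {α : Type*} {S : Finset α} {a b c : α → Fin 2 → ℤ} {k : Fin 2 → ℤ}
    {A B s₁ s₂ s₃ μ : ℝ} (hA : 1 ≤ A) (hAB : A ≤ B)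
    (hs₁ : s₁ = -1 ∨ s₁ = 1) (hs₃ : s₃ = -1 ∨ s₃ = 1)
    (hinj : ∀ p ∈ S, ∀ r ∈ S, a p = a r → b p = b r → p = r)
    (hsum : ∀ p ∈ S, a p + b p + c p = k)
    (ha : ∀ p ∈ S, ann A (a p)) (hb : ∀ p ∈ S, ann B (b p))
    (h : ∀ p ∈ S, |s₁ * jb (a p) + s₂ * jb (b p) + s₃ * jb (c p) - μ| ≤ 1) :
    (S.card : ℝ) ≤ 250000 * B ^ 2 * A ^ ((3 : ℝ) / 2) := by
  have hA0 : 0 < A := by linarith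
  have hB : 1 ≤ B := hA.trans hAB
  have hB0 : 0 < B := by linarith
  have hfib : ∀ j i : ℤ, (((S.filter (fun p => b p 0 = j)).filter (fun p => b p 1 = i)).card : ℝ) ≤
      2100 * (A * (√A + A * (1 / √(max 1 |((k 0 - j : ℤ) : ℝ)|)))) := by
    intro j i
    have hmem : ∀ p ∈ (S.filter (fun p => b p 0 = j)).filter (fun p => b p 1 = i),
        p ∈ S ∧ b p 0 = j ∧ b p 1 = i := by
      intro p hp
      simp only [Finset.mem_filter] at hp
      exact ⟨hp.1.1, hp.1.2, hp.2⟩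
    refine card_bracket_le (x := fun p => a p 0) (y := fun p => a p 1) (s := s₁ * s₃)
      (μ := s₁ * (μ - s₂ * √(1 + (j : ℝ) ^ 2 + (i : ℝ) ^ 2))) (k 0 - j) (k 1 - i) hA ?_ ?_ ?_ ?_ ?_
    · rcases hs₁ with rfl | rfl <;> rcases hs₃ with rfl | rfl <;> norm_num
    · intro p hp r hr h0 h1
      obtain ⟨hpS, hp0, hp1⟩ := hmem p hp
      obtain ⟨hrS, hr0, hr1⟩ := hmem r hr
      apply hinj p hpS r hrS
      · ext t; fin_cases t
        · exact h0
        · exact h1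
      · ext t; fin_cases t
        · exact hp0.trans hr0.symm
        · exact hp1.trans hr1.symm
    · exact fun p hp => (ann_sq_bounds hA0.le (ha p (hmem p hp).1)).1
    · exact fun p hp => (ann_sq_bounds hA0.le (ha p (hmem p hp).1)).2
    · intro p hp
      obtain ⟨hpS, hp0, hp1⟩ := hmem p hp
      have hc0 : ((k 0 - j : ℤ) : ℝ) - a p 0 = c p 0 := by
        have := congrFun (hsum p hpS) 0
        simp only [Pi.add_apply] at this
        rw [← this, hp0]; push_cast; ring
      have hc1 : ((k 1 - i : ℤ) : ℝ) - a p 1 = c p 1 := by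
        have := congrFun (hsum p hpS) 1
        simp only [Pi.add_apply] at this
        rw [← this, hp1]; push_cast; ring
      have hp := h p hpS
      simp only [jb, hp0, hp1] at hp
      rw [hc0, hc1]
      have hs : |s₁| = 1 := by rcases hs₁ with rfl | rfl <;> norm_num
      have hs2 : s₁ ^ 2 = 1 := by rcases hs₁ with rfl | rfl <;> norm_num
      refine le_of_eq_of_le ?_ hp
      rw [← one_mul |s₁ * _ + _ + _ - μ|, ← hs, ← abs_mul, hs]
      congr 1
      linear_combination -√(1 + (a p 0 : ℝ) ^ 2 + (a p 1 : ℝ) ^ 2) * hs2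
  have hslice : ∀ j : ℤ, ((S.filter (fun p => b p 0 = j)).card : ℝ) ≤
      5 * B * (2100 * (A * (√A + A * (1 / √(max 1 |((k 0 - j : ℤ) : ℝ)|))))) := by
    intro j
    refine card_le_mul_of_fiber_le (x := fun p => b p 1) hB (by positivity) ?_ (hfib j)
    intro p hp
    exact ann_abs_le hB0.le (hb p (Finset.mem_filter.1 hp).1) 1
  have htot := card_le_sum_of_fiber_le (f := fun p => b p 0)
    (fun p hp => mem_Icc_floor (ann_abs_le hB0.le (hb p hp) 0)) (fun j _ => hslice j)
  rw [← Finset.mul_sum, ← Finset.mul_sum, ← Finset.mul_sum, Finset.sum_add_distrib,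
    ← Finset.mul_sum, Finset.sum_const, nsmul_eq_mul] at htot
  have hrpow : A ^ ((3 : ℝ) / 2) = A * √A := by
    rw [Real.sqrt_eq_rpow, ← Real.rpow_one_add' hA0.le (by norm_num)]
    norm_num
  rw [hrpow]
  have hcard := card_Icc_floor_le hB
  have hsqrt := sum_Icc_one_div_sqrt_shift_le hB (k 0)
  have hAB' : A * √B ≤ √A * B := by
    have e1 : √A ^ 2 = A := Real.sq_sqrt hA0.le
    have e2 : √B ^ 2 = B := Real.sq_sqrt hB0.le
    have e3 : √A ≤ √B := Real.sqrt_le_sqrt hAB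
    calc A * √B = √A * √B * √A := by linear_combination -√B * e1
      _ ≤ √A * √B * √B := by gcongr
      _ = √A * B := by linear_combination √A * e2
  refine htot.trans ?_
  calc _ ≤ 5 * B * (2100 * (A * (5 * B * √A + A * (16 * √B)))) := by gcongr
    _ ≤ 5 * B * (2100 * (A * (5 * B * √A + 16 * (√A * B)))) := by
      gcongr 5 * B * (2100 * (A * (5 * B * √A + ?_)))
      linarith
    _ ≤ 250000 * B ^ 2 * (A * √A) := by
      have : 0 ≤ B ^ 2 * (A * √A) := by positivity
      linarith

lemma finite_setOf_ann {N : ℝ} (hN : 0 ≤ N) : {x : Fin 2 → ℤ | ann N x}.Finite := by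
  apply (Finset.finite_toSet
    (Fintype.piFinset fun _ : Fin 2 => Finset.Icc (-⌊2 * N⌋) ⌊2 * N⌋)).subset
  intro x hx
  simp only [Finset.mem_coe, Fintype.mem_piFinset]
  exact fun i => mem_Icc_floor (ann_abs_le hN hx i)

lemma jb_neg (x : Fin 2 → ℤ) : jb (-x) = jb x := by simp [jb]

lemma ann_neg {N : ℝ} {x : Fin 2 → ℤ} (h : ann N x) : ann N (-x) := by
  simpa [ann, znorm] using h

/-- cubic sup-counting estimate, second form: there is a universal `C > 0` such
that for all signs, dyadic `N₁₂₃, N₁, N₂`, every `m ∈ ℤ` and every `n₃ ∈ ℤ²`,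
`#{(n₁,n₂) : |n₁| ∼ N₁, |n₂| ∼ N₂, |n₁+n₂+n₃| ∼ N₁₂₃, |φ−m| ≤ 1}
  ≤ C med(N₁₂₃,N₁,N₂)² min(N₁₂₃,N₁,N₂)^{3/2}`. -/
theorem cubic_sup_counting_ii :
    ∃ C : ℝ, 0 < C ∧
      ∀ (σ σ₁ σ₂ σ₃ : ℝ), (σ = -1 ∨ σ = 1) → (σ₁ = -1 ∨ σ₁ = 1) →
        (σ₂ = -1 ∨ σ₂ = 1) → (σ₃ = -1 ∨ σ₃ = 1) →
        ∀ (k₁₂₃ k₁ k₂ : ℕ) (m : ℤ) (n₃ : Fin 2 → ℤ),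
          (cubicSupSet' σ σ₁ σ₂ σ₃ ((2:ℝ)^k₁) ((2:ℝ)^k₂) ((2:ℝ)^k₁₂₃) n₃ m).Finite ∧
          ((cubicSupSet' σ σ₁ σ₂ σ₃ ((2:ℝ)^k₁) ((2:ℝ)^k₂) ((2:ℝ)^k₁₂₃) n₃ m).ncard : ℝ) ≤
            C * (med3 ((2:ℝ)^k₁₂₃) ((2:ℝ)^k₁) ((2:ℝ)^k₂)) ^ 2 *
              (min ((2:ℝ)^k₁₂₃) (min ((2:ℝ)^k₁) ((2:ℝ)^k₂))) ^ ((3:ℝ)/2) := by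
  refine ⟨250000, by norm_num, ?_⟩
  intro σ σ₁ σ₂ σ₃ hσ hσ₁ hσ₂ hσ₃ k₁₂₃ k₁ k₂ m n₃
  have hN₁ : (1 : ℝ) ≤ 2 ^ k₁ := one_le_pow₀ (by norm_num)
  have hN₂ : (1 : ℝ) ≤ 2 ^ k₂ := one_le_pow₀ (by norm_num)
  have hN : (1 : ℝ) ≤ 2 ^ k₁₂₃ := one_le_pow₀ (by norm_num)
  generalize (2 : ℝ) ^ k₁ = N₁ at *
  generalize (2 : ℝ) ^ k₂ = N₂ at *
  generalize (2 : ℝ) ^ k₁₂₃ = N at *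
  have hfin : (cubicSupSet' σ σ₁ σ₂ σ₃ N₁ N₂ N n₃ m).Finite :=
    ((finite_setOf_ann (by linarith : 0 ≤ N₁)).prod
      (finite_setOf_ann (by linarith : 0 ≤ N₂))).subset fun p hp => ⟨hp.1, hp.2.1⟩
  refine ⟨hfin, ?_⟩
  rw [Set.ncard_eq_toFinset_card _ hfin]
  have hmem : ∀ p ∈ hfin.toFinset, p ∈ cubicSupSet' σ σ₁ σ₂ σ₃ N₁ N₂ N n₃ m :=
    fun p hp => hfin.mem_toFinset.1 hp
  set S := hfin.toFinset
  let a : (Fin 2 → ℤ) × (Fin 2 → ℤ) → Fin 2 → ℤ := fun p => p.1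
  let b : (Fin 2 → ℤ) × (Fin 2 → ℤ) → Fin 2 → ℤ := fun p => p.2
  let c : (Fin 2 → ℤ) × (Fin 2 → ℤ) → Fin 2 → ℤ := fun p => -(p.1 + p.2 + n₃)
  have ha : ∀ p ∈ S, ann N₁ (a p) := fun p hp => (hmem p hp).1
  have hb : ∀ p ∈ S, ann N₂ (b p) := fun p hp => (hmem p hp).2.1
  have hc : ∀ p ∈ S, ann N (c p) := fun p hp => ann_neg (hmem p hp).2.2.1
  have hsum : ∀ p, a p + b p + c p = -n₃ := fun p => by simp only [a, b, c]; abel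
  have hph : ∀ p ∈ S, |σ₁ * jb (a p) + σ₂ * jb (b p) + σ * jb (c p) - (m - σ₃ * jb n₃)| ≤ 1 := by
    intro p hp
    convert (hmem p hp).2.2.2 using 2
    simp only [a, b, c, jb_neg, phase]
    ring
  have hab : ∀ p r, a p = a r → b p = b r → p = r := fun p r h1 h2 => Prod.ext h1 h2
  have hac : ∀ p r, a p = a r → c p = c r → p = r := fun p r h1 h2 => hab p r h1 <| by
    have := (hsum p).trans (hsum r).symm
    rw [h1, h2] at this
    simpa using this
  have hbc : ∀ p r, b p = b r → c p = c r → p = r := fun p r h1 h2 => hab p r (by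
    have := (hsum p).trans (hsum r).symm
    rw [h1, h2] at this
    simpa using this) h1
  rcases le_total N₁ N₂ with h12 | h12
  · rcases le_total N₂ N with h2 | h2
    · have hmin : min N (min N₁ N₂) = N₁ := by grind
      have hmed : med3 N N₁ N₂ = N₂ := by grind [med3]
      rw [hmin, hmed]
      exact card_triple_le (a := a) (b := b) (c := c) (k := -n₃) (s₂ := σ₂)
        (μ := m - σ₃ * jb n₃) hN₁ h12 hσ₁ hσ (fun p _ r _ => hab p r) (fun p _ => hsum p) ha hb hph
    · rcases le_total N₁ N with h1 | h1
      · have hmin : min N (min N₁ N₂) = N₁ := by grind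
        have hmed : med3 N N₁ N₂ = N := by grind [med3]
        rw [hmin, hmed]
        refine card_triple_le (a := a) (b := c) (c := b) (k := -n₃) (s₂ := σ)
          (μ := m - σ₃ * jb n₃) hN₁ h1 hσ₁ hσ₂ (fun p _ r _ => hac p r)
          (fun p _ => ?_) ha hc (fun p hp => ?_)
        · rw [← hsum p]; abel
        · convert hph p hp using 2; ring
      · have hmin : min N (min N₁ N₂) = N := by grind
        have hmed : med3 N N₁ N₂ = N₁ := by grind [med3]
        rw [hmin, hmed]
        refine card_triple_le (a := c) (b := a) (c := b) (k := -n₃) (s₂ := σ₁)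
          (μ := m - σ₃ * jb n₃) hN h1 hσ hσ₂ (fun p _ r _ h1 h2 => hac p r h2 h1)
          (fun p _ => ?_) hc ha (fun p hp => ?_)
        · rw [← hsum p]; abel
        · convert hph p hp using 2; ring
  · rcases le_total N₁ N with h1 | h1
    · have hmin : min N (min N₁ N₂) = N₂ := by grind
      have hmed : med3 N N₁ N₂ = N₁ := by grind [med3]
      rw [hmin, hmed]
      refine card_triple_le (a := b) (b := a) (c := c) (k := -n₃) (s₂ := σ₁)
        (μ := m - σ₃ * jb n₃) hN₂ h12 hσ₂ hσ (fun p _ r _ h1 h2 => hab p r h2 h1)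
        (fun p _ => ?_) hb ha (fun p hp => ?_)
      · rw [← hsum p]; abel
      · convert hph p hp using 2; ring
    · rcases le_total N₂ N with h2 | h2
      · have hmin : min N (min N₁ N₂) = N₂ := by grind
        have hmed : med3 N N₁ N₂ = N := by grind [med3]
        rw [hmin, hmed]
        refine card_triple_le (a := b) (b := c) (c := a) (k := -n₃) (s₂ := σ)
          (μ := m - σ₃ * jb n₃) hN₂ h2 hσ₂ hσ₁ (fun p _ r _ => hbc p r)
          (fun p _ => ?_) hb hc (fun p hp => ?_)
        · rw [← hsum p]; abel
        · convert hph p hp using 2; ring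
      · have hmin : min N (min N₁ N₂) = N := by grind
        have hmed : med3 N N₁ N₂ = N₂ := by grind [med3]
        rw [hmin, hmed]
        refine card_triple_le (a := c) (b := b) (c := a) (k := -n₃) (s₂ := σ₂)
          (μ := m - σ₃ * jb n₃) hN h2 hσ hσ₁ (fun p _ r _ h1 h2 => hbc p r h2 h1)
          (fun p _ => ?_) hc hb (fun p hp => ?_)
        · rw [← hsum p]; abel
        · convert hph p hp using 2; ring
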